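/- Let α : Q → P be a surjective morphism between countable PO systems and let 𝒴 be a bounded trim (Q, M, g)-partition of the ω-Stone space W. Then the regular consolidation 𝒴α is a bounded trim (P, L, f)-partition of W, where L = {p ∈ P | α⁻¹(p) ⊆ M} and f(p) = Σ_{q ∈ α⁻¹(p)} g(q) for p ∈ L_min^d. -/

import Mathlib

open Set Filter Topology

universe u v

/-- A PO system: a set with a transitive antisymmetric relation `<`. -/
structure POSystem (P : Type u) : Type u where
  lt : P → P → Prop
  lt_trans : ∀ {a b c}, lt a b → lt b c → lt a c
  lt_antisymm : ∀ {a b}, lt a b → lt b a → a = b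

namespace POSystem

variable {P : Type*} {Q : Type*}

/-- `a ≤ b` iff `a < b` or `a = b`. -/
def le (S : POSystem P) (a b : P) : Prop := S.lt a b ∨ a = b

theorem le_trans {S : POSystem P} {a b c : P} (h1 : S.le a b) (h2 : S.le b c) :
    S.le a c := by
  rcases h1 with h1 | rfl
  · rcases h2 with h2 | rfl
    · exact Or.inl (S.lt_trans h1 h2)
    · exact Or.inl h1
  · exact h2

/-- A morphism of PO systems. -/
def IsMorphism (SQ : POSystem Q) (SP : POSystem P) (α : Q → P) : Prop :=
  ∀ q : Q, α '' {r | SQ.lt q r} = {p | SP.lt (α q) p}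

/-- An isomorphism of PO systems. -/
def IsIso (SQ : POSystem Q) (SP : POSystem P) (β : Q → P) : Prop :=
  Function.Bijective β ∧ ∀ a b : Q, SQ.lt a b ↔ SP.lt (β a) (β b)

/-- An ideal of a PO system: a nonempty directed lower subset. -/
def IsIdeal (S : POSystem P) (J : Set P) : Prop :=
  J.Nonempty ∧ (∀ x ∈ J, ∀ y : P, S.le y x → y ∈ J) ∧
    ∀ x ∈ J, ∀ y ∈ J, ∃ z ∈ J, S.le x z ∧ S.le y z

/-- An ideal of a subset `Qs` of a PO system. -/
def IsIdealOf (S : POSystem P) (Qs : Set P) (J : Set P) : Prop :=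
  J.Nonempty ∧ J ⊆ Qs ∧ (∀ x ∈ J, ∀ y ∈ Qs, S.le y x → y ∈ J) ∧
    ∀ x ∈ J, ∀ y ∈ J, ∃ z ∈ J, S.le x z ∧ S.le y z

/-- The principal ideal `p↓`. -/
def principalIdeal (S : POSystem P) (p : P) : Set P := {q | S.le q p}

theorem principal_isIdeal (S : POSystem P) (p : P) : IsIdeal S (principalIdeal S p) :=
  ⟨⟨p, Or.inr rfl⟩, fun _ hx y hy => le_trans hy hx,
    fun _ hx _ hy => ⟨p, Or.inr rfl, hx, hy⟩⟩

/-- `p` is the supremum of the subset `A`. -/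
def IsSupOf (S : POSystem P) (p : P) (A : Set P) : Prop :=
  (∀ a ∈ A, S.le a p) ∧ ∀ q : P, (∀ a ∈ A, S.le a q) → S.le p q

/-- `p` is separated in `P` if it is not the supremum of a strictly increasing sequence. -/
def Separated (S : POSystem P) (p : P) : Prop :=
  ¬ ∃ u : ℕ → P, (∀ n, S.lt (u n) (u (n + 1)) ∧ u n ≠ u (n + 1)) ∧
      IsSupOf S p (Set.range u)

/-- `p` is compact in `P`. -/
def CompactIn (S : POSystem P) (p : P) : Prop :=
  ∀ J : Set P, IsIdeal S J → ∀ s : P, IsSupOf S s J → S.le p s → p ∈ J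

/-- The lower closure `N↓` of a subset. -/
def downSet (S : POSystem P) (N : Set P) : Set P := {p | ∃ q ∈ N, S.le p q}

/-- `N` has a finite foundation. -/
def HasFinFoundation (S : POSystem P) (N : Set P) : Prop :=
  ∃ F : Set P, F.Finite ∧ F ⊆ downSet S N ∧ ∀ r ∈ downSet S N, ∃ p ∈ F, S.le p r

def PDelta (S : POSystem P) : Set P := {p | HasFinFoundation S {p}}

def IsLowerSubset (S : POSystem P) (L : Set P) : Prop :=
  ∀ p ∈ L, ∀ q : P, S.le q p → q ∈ L

/-- Minimal elements of `L`. -/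
def minIn (S : POSystem P) (L : Set P) : Set P :=
  {p | p ∈ L ∧ ∀ q ∈ L, S.le q p → q = p}

/-- `L_min^d`: minimal elements of `L` lying in `P^d`. -/
def LminD (S : POSystem P) (L : Set P) : Set P := {p | p ∈ minIn S L ∧ ¬ S.lt p p}

/-- `(P, L, f)` is an extended PO system. -/
def IsExtPO (S : POSystem P) (L : Set P) (f : P → ℕ) : Prop :=
  IsLowerSubset S L ∧ L ⊆ PDelta S ∧ ∀ p ∈ LminD S L, 0 < f p

/-- The order relation on the ideal completion `id(P)`: ordered by inclusion, with
`id(P)^d` the principal ideals `p↓` for `p ∈ P^d`. -/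
def idLt (S : POSystem P) (J K : {J : Set P // IsIdeal S J}) : Prop :=
  (J.1 ⊆ K.1 ∧ J ≠ K) ∨ (J = K ∧ ¬ ∃ p : P, ¬ S.lt p p ∧ J.1 = principalIdeal S p)

/-- The ideal completion `id(P)` of a PO system. -/
def idPO (S : POSystem P) : POSystem {J : Set P // IsIdeal S J} where
  lt := idLt S
  lt_trans := by
    intro a b c h1 h2
    unfold idLt at h1 h2 ⊢
    rcases h1 with ⟨hab, hne⟩ | ⟨heq, h⟩
    · rcases h2 with ⟨hbc, hne'⟩ | ⟨heq', h'⟩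
      · refine Or.inl ⟨hab.trans hbc, fun hac => hne ?_⟩
        exact Subtype.ext (subset_antisymm hab (by rw [hac]; exact hbc))
      · rw [← heq']; exact Or.inl ⟨hab, hne⟩
    · rw [heq]; exact h2
  lt_antisymm := by
    intro a b h1 h2
    unfold idLt at h1 h2
    rcases h1 with ⟨hab, _⟩ | ⟨heq, _⟩
    · rcases h2 with ⟨hba, _⟩ | ⟨heq, _⟩
      · exact Subtype.ext (subset_antisymm hab hba)
      · exact heq.symm
    · exact heq

/-- The restriction of a PO system to a subset. -/
def restrictPO (S : POSystem P) (T : Set P) : POSystem T where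
  lt a b := S.lt a b
  lt_trans := fun h1 h2 => S.lt_trans h1 h2
  lt_antisymm := fun h1 h2 => Subtype.ext (S.lt_antisymm h1 h2)

end POSystem

open POSystem

section Partitions

variable {W : Type*} [TopologicalSpace W] {P : Type*} {Q : Type*}

/-- The derived set (set of limit points) of `A`. -/
def limitPts (A : Set W) : Set W := {x | x ∈ closure (A \ {x})}

/-- The type `T(A)` of a subset `A` with respect to a partition `X`. -/
def ptype (X : P → Set W) (A : Set W) : Set P := {p | (A ∩ X p).Nonempty}

/-- A `P`-partition of `W`: pairwise disjoint nonempty sets `X p` such that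
`(X p)' ∩ X = ⋃_{q < p} X q`. -/
def IsPPartition (S : POSystem P) (X : P → Set W) : Prop :=
  (∀ p, (X p).Nonempty) ∧ (Pairwise fun p q => Disjoint (X p) (X q)) ∧
    ∀ p, limitPts (X p) ∩ (⋃ q, X q) = ⋃ q ∈ {q : P | S.lt q p}, X q

/-- `A` is a `p`-trim set. -/
def IsTrimAt (S : POSystem P) (X : P → Set W) (A : Set W) (p : P) : Prop :=
  IsCompact A ∧ IsOpen A ∧ ptype X A = {q | S.le p q} ∧
    (¬ S.lt p p → ∃! x, x ∈ A ∩ X p)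

/-- `A` is a trim set. -/
def IsTrimSet (S : POSystem P) (X : P → Set W) (A : Set W) : Prop :=
  ∃ p, IsTrimAt S X A p

/-- `P̂`: the set of `p` for which some `p`-trim set exists. -/
def Phat (S : POSystem P) (X : P → Set W) : Set P := {p | ∃ A, IsTrimAt S X A p}

/-- Axiom T1: every point has a neighbourhood base of trim sets. -/
def HasTrimBases (S : POSystem P) (X : P → Set W) : Prop :=
  ∀ w : W, ∀ U ∈ nhds w, ∃ A, IsTrimSet S X A ∧ w ∈ A ∧ A ⊆ U

/-- Axiom T2 (fullness). -/
def IsFull (S : POSystem P) (X : P → Set W) : Prop :=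
  ∀ p ∈ Phat S X, ∀ w : W,
    (∀ U ∈ nhds w, ∃ A, IsTrimAt S X A p ∧ w ∈ A ∧ A ⊆ U) → w ∈ X p

/-- `w` is a clean point. -/
def IsCleanPt (S : POSystem P) (X : P → Set W) (w : W) : Prop :=
  ∃ p, w ∈ X p ∧ ∃ A, IsTrimAt S X A p ∧ w ∈ A

/-- Axiom T3: all points of `X` are clean. -/
def AllClean (S : POSystem P) (X : P → Set W) : Prop :=
  ∀ p : P, ∀ w ∈ X p, ∃ A, IsTrimAt S X A p ∧ w ∈ A

/-- A trim `P`-partition. -/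
def IsTrimPartition (S : POSystem P) (X : P → Set W) : Prop :=
  IsPPartition S X ∧ HasTrimBases S X ∧ IsFull S X ∧ AllClean S X

/-- A complete partition: the blocks cover `W`. -/
def IsCompletePartition (X : P → Set W) : Prop := (⋃ p, X p) = Set.univ

/-- `Y` refines `Z` via `α`. -/
def Refines (Y : Q → Set W) (Z : P → Set W) (α : Q → P) : Prop :=
  ∀ q, Y q ⊆ Z (α q)

/-- `Y` regularly refines `Z` via `α` (`Z` regularly consolidates `Y` via `α`). -/
def RegRefines (SQ : POSystem Q) (SP : POSystem P) (Y : Q → Set W) (Z : P → Set W)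
    (α : Q → P) : Prop :=
  Refines Y Z α ∧ ∀ p ∈ Phat SP Z, ∀ A : Set W, IsTrimAt SP Z A p → p ∈ α '' ptype Y A

/-- A semi-trim partition: T1, T2, and clean points are dense in each `X p`, `p ∈ P̂`. -/
def IsSemiTrim (S : POSystem P) (X : P → Set W) : Prop :=
  IsPPartition S X ∧ HasTrimBases S X ∧ IsFull S X ∧
    ∀ p ∈ Phat S X, X p ⊆ closure {w | w ∈ X p ∧ ∃ A, IsTrimAt S X A p ∧ w ∈ A}

/-- A strongly semi-trim partition: T1, T2, and all points of `X p` are clean, `p ∈ P̂`. -/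
def IsStronglySemiTrim (S : POSystem P) (X : P → Set W) : Prop :=
  IsPPartition S X ∧ HasTrimBases S X ∧ IsFull S X ∧
    ∀ p ∈ Phat S X, ∀ w ∈ X p, ∃ A, IsTrimAt S X A p ∧ w ∈ A

/-- The labels of a sequence are pairwise strictly incomparable or strictly increasing. -/
def PairwiseIncompOrStrictIncr (S : POSystem P) (τ : ℕ → P) : Prop :=
  (∀ j k, j ≠ k → ¬ S.le (τ j) (τ k)) ∨ (∀ j k, j < k → S.lt (τ j) (τ k) ∧ τ j ≠ τ k)

/-- A rank `P`-partition: a complete `P`-partition satisfying RP1 and RP2. -/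
def IsRankPartition (S : POSystem P) (X : P → Set W) : Prop :=
  IsPPartition S X ∧ IsCompletePartition X ∧
    (∀ q : P, Separated S q → ∀ (x : W) (u : ℕ → W) (τx : P) (τu : ℕ → P),
      x ∈ X τx → (∀ k, u k ∈ X (τu k)) →
      Filter.Tendsto u Filter.atTop (nhds x) → (∀ k, u k ≠ x) →
      S.le q τx → PairwiseIncompOrStrictIncr S τu →
      ∀ᶠ k in Filter.atTop, S.le q (τu k)) ∧
    (∀ (x : W) (τx : P), x ∈ X τx → ¬ Separated S τx →
      ∃ u : ℕ → W, Filter.Tendsto u Filter.atTop (nhds x) ∧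
        ∀ k, ∃ q, u k ∈ X q ∧ S.lt q τx ∧ q ≠ τx)

/-- `I_w`: the set of types of trim neighbourhoods of `w`. -/
def Iw (S : POSystem P) (X : P → Set W) (w : W) : Set P :=
  {p | ∃ A : Set W, IsTrimAt S X A p ∧ w ∈ A}

/-- A trim `(P, L, f)`-partition. -/
def IsTrimPLF (S : POSystem P) (L : Set P) (f : P → ℕ) (Z : P → Set W) : Prop :=
  IsTrimPartition S Z ∧ (∀ p, IsCompact (closure (Z p)) ↔ p ∈ L) ∧
    ∀ p ∈ LminD S L, Nat.card (Z p) = f p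

/-- A bounded trim `(P, L, f)`-partition. -/
def IsBoundedTrimPLF (S : POSystem P) (L : Set P) (f : P → ℕ) (Z : P → Set W) : Prop :=
  IsTrimPLF S L f Z ∧ IsCompact (closure (⋃ p ∈ L, Z p))

end Partitions

section Primitive

variable {W : Type*} [TopologicalSpace W]

/-- The ideal `(A)` of compact open subsets of `A`. -/
def coIdeal (A : Set W) : Set (Set W) := {C | IsCompact C ∧ IsOpen C ∧ C ⊆ A}

/-- `(A) ≅ (B)` as Boolean rings (equivalently, as posets). -/
def IdealIso (A B : Set W) : Prop := Nonempty (↥(coIdeal A) ≃o ↥(coIdeal B))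

/-- `(A) × (B) ≅ (A)`. -/
def ProdIdealIso (A B : Set W) : Prop :=
  Nonempty ((↥(coIdeal A) × ↥(coIdeal B)) ≃o ↥(coIdeal A))

/-- A compact open `A` is pseudo-indecomposable (PI). -/
def IsPISet (A : Set W) : Prop :=
  IsCompact A ∧ IsOpen A ∧ ∀ B : Set W, IsCompact B → IsOpen B → B ⊆ A →
    IdealIso B A ∨ IdealIso (A \ B) A

/-- `W` is primitive: every compact open set is a finite disjoint union of PI sets. -/
def PrimitiveSpace (W : Type*) [TopologicalSpace W] : Prop :=
  ∀ A : Set W, IsCompact A → IsOpen A →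
    ∃ (n : ℕ) (F : Fin n → Set W), (∀ i, IsPISet (F i)) ∧
      (Pairwise fun i j => Disjoint (F i) (F j)) ∧ A = ⋃ i, F i

/-- The setoid of PI compact opens up to isomorphism of their ideals. -/
def piIsoSetoid (W : Type*) [TopologicalSpace W] : Setoid {A : Set W // IsPISet A} where
  r A B := IdealIso A.1 B.1
  iseqv := ⟨fun _ => ⟨OrderIso.refl _⟩,
    fun h => h.elim fun e => ⟨e.symm⟩,
    fun h1 h2 => h1.elim fun e => h2.elim fun f => ⟨e.trans f⟩⟩

/-- The underlying set of the structure diagram `𝒮(W)`: isomorphism classes of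
PI compact open subsets of `W`. -/
def SDiagram (W : Type*) [TopologicalSpace W] : Type _ := Quotient (piIsoSetoid W)

/-- The relation on `𝒮(W)`: `[A] < [B]` iff `(A) × (B) ≅ (A)`. -/
def SDiagramLt {W : Type*} [TopologicalSpace W] (x y : SDiagram W) : Prop :=
  ∃ A B : {A : Set W // IsPISet A}, x = Quotient.mk (piIsoSetoid W) A ∧
    y = Quotient.mk (piIsoSetoid W) B ∧ ProdIdealIso A.1 B.1

/-- The blocks of the canonical partition `𝒳(W)`: points having a neighbourhood base
of compact open sets of class `p`. -/
def canonicalBlock {W : Type*} [TopologicalSpace W] (p : SDiagram W) : Set W :=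
  {w | ∀ U ∈ nhds w, ∃ A : {A : Set W // IsPISet A},
      Quotient.mk (piIsoSetoid W) A = p ∧ w ∈ A.1 ∧ A.1 ⊆ U}

/-- The setoid of points of `W` under the homeomorphism group. -/
def homeoSetoid (W : Type*) [TopologicalSpace W] : Setoid W where
  r w x := ∃ h : W ≃ₜ W, h w = x
  iseqv := ⟨fun w => ⟨Homeomorph.refl W, rfl⟩,
    fun h => h.elim fun e he => ⟨e.symm, by rw [← he, Homeomorph.symm_apply_apply]⟩,
    fun h1 h2 => h1.elim fun e he => h2.elim fun f hf =>
      ⟨e.trans f, by rw [Homeomorph.trans_apply, he, hf]⟩⟩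

end Primitive

section Aux

variable {W : Type*} [TopologicalSpace W] {P : Type*} {Q : Type*}

theorem aux_le_antisymm {S : POSystem P} {a b : P} (h1 : S.le a b) (h2 : S.le b a) : a = b := by
  rcases h1 with h1 | rfl
  · rcases h2 with h2 | rfl
    · exact S.lt_antisymm h1 h2
    · rfl
  · rfl

theorem aux_mor_lt {SQ : POSystem Q} {SP : POSystem P} {α : Q → P}
    (hmor : POSystem.IsMorphism SQ SP α) {q r : Q} (h : SQ.lt q r) : SP.lt (α q) (α r) := by
  have : α r ∈ α '' {r | SQ.lt q r} := ⟨r, h, rfl⟩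
  rw [hmor q] at this
  exact this

theorem aux_mor_lift {SQ : POSystem Q} {SP : POSystem P} {α : Q → P}
    (hmor : POSystem.IsMorphism SQ SP α) {q : Q} {p : P} (h : SP.lt (α q) p) :
    ∃ r, SQ.lt q r ∧ α r = p := by
  have : p ∈ {p | SP.lt (α q) p} := h
  rw [← hmor q] at this
  exact this

theorem aux_mor_le {SQ : POSystem Q} {SP : POSystem P} {α : Q → P}
    (hmor : POSystem.IsMorphism SQ SP α) {q r : Q} (h : SQ.le q r) : SP.le (α q) (α r) := by
  rcases h with h | rfl
  · exact Or.inl (aux_mor_lt hmor h)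
  · exact Or.inr rfl

theorem aux_mem_type {S : POSystem P} {X : P → Set W} {A : Set W} {p q : P}
    (hA : IsTrimAt S X A p) : (A ∩ X q).Nonempty ↔ S.le p q := by
  have : q ∈ ptype X A ↔ q ∈ {q | S.le p q} := by rw [hA.2.2.1]
  exact this

theorem aux_sub_le {S : POSystem P} {X : P → Set W} {A B : Set W} {p q : P}
    (hA : IsTrimAt S X A p) (hB : IsTrimAt S X B q) (h : B ⊆ A) : S.le p q := by
  rw [← aux_mem_type hA]
  exact ((aux_mem_type hB).2 (Or.inr rfl)).mono (inter_subset_inter_left _ h)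

/-- A point of `X p` has a base of `p`-trim sets. -/
theorem aux_base {S : POSystem P} {X : P → Set W} (hX : IsTrimPartition S X) {p : P} {w : W}
    (hw : w ∈ X p) {U : Set W} (hU : U ∈ nhds w) : ∃ A, IsTrimAt S X A p ∧ w ∈ A ∧ A ⊆ U := by
  obtain ⟨A, hA, hwA⟩ := hX.2.2.2 p w hw
  obtain ⟨B, ⟨r, hB⟩, hwB, hBU⟩ := hX.2.1 w (A ∩ U) (inter_mem (hA.2.1.mem_nhds hwA) hU)
  have h1 := aux_sub_le hA hB (hBU.trans inter_subset_left)
  have h2 : S.le r p := (aux_mem_type hB).1 ⟨w, hwB, hw⟩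
  obtain rfl := aux_le_antisymm h1 h2
  exact ⟨B, hB, hwB, hBU.trans inter_subset_right⟩

def auxZ (SQ : POSystem Q) (α : Q → P) (Y : Q → Set W) (p : P) : Set W :=
  {w | ∀ U ∈ nhds w, ∃ A q, IsTrimAt SQ Y A q ∧ α q = p ∧ w ∈ A ∧ A ⊆ U}

theorem aux_Y_sub {SQ : POSystem Q} {α : Q → P} {Y : Q → Set W} (hY : IsTrimPartition SQ Y)
    (q : Q) : Y q ⊆ auxZ SQ α Y (α q) := by
  intro w hw U hU
  obtain ⟨A, hA, hwA, hAU⟩ := aux_base hY hw hU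
  exact ⟨A, q, hA, rfl, hwA, hAU⟩

theorem aux_trim {SQ : POSystem Q} {SP : POSystem P} {α : Q → P} {Y : Q → Set W}
    (hmor : POSystem.IsMorphism SQ SP α) (hY : IsTrimPartition SQ Y) {A : Set W} {q : Q}
    (hA : IsTrimAt SQ Y A q) : IsTrimAt SP (auxZ SQ α Y) A (α q) := by
  refine ⟨hA.1, hA.2.1, ?_, ?_⟩
  · ext p
    constructor
    · rintro ⟨w, hwA, hw⟩
      obtain ⟨B, r, hB, rfl, hwB, hBA⟩ := hw A (hA.2.1.mem_nhds hwA)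
      exact aux_mor_le hmor (aux_sub_le hA hB hBA)
    · intro h
      have : ∃ r, SQ.le q r ∧ α r = p := by
        rcases h with h | h
        · obtain ⟨r, hr, h⟩ := aux_mor_lift hmor h
          exact ⟨r, Or.inl hr, h⟩
        · exact ⟨q, Or.inr rfl, h⟩
      obtain ⟨r, hr, rfl⟩ := this
      exact ((aux_mem_type hA).2 hr).mono (inter_subset_inter_right _ (aux_Y_sub hY r))
  · intro hd
    have hqd : ¬ SQ.lt q q := fun h => hd (aux_mor_lt hmor h)
    obtain ⟨x, hx, hu⟩ := hA.2.2.2 hqd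
    refine ⟨x, ⟨hx.1, aux_Y_sub hY q hx.2⟩, ?_⟩
    rintro w ⟨hwA, hw⟩
    refine hu w ⟨hwA, hY.2.2.1 q ⟨A, hA⟩ w ?_⟩
    intro U hU
    obtain ⟨B, r, hB, hr, hwB, hBA⟩ := hw (A ∩ U) (inter_mem (hA.2.1.mem_nhds hwA) hU)
    rcases aux_sub_le hA hB (hBA.trans inter_subset_left) with h | rfl
    · have h1 := aux_mor_lt hmor h
      rw [hr] at h1
      exact absurd h1 hd
    · exact ⟨B, hB, hwB, hBA.trans inter_subset_right⟩

theorem aux_exists {SQ : POSystem Q} {SP : POSystem P} {α : Q → P} {Y : Q → Set W}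
    (hsurj : Function.Surjective α)
    (hmor : POSystem.IsMorphism SQ SP α) (hY : IsTrimPartition SQ Y) :
    IsTrimPartition SP (auxZ SQ α Y) ∧ RegRefines SQ SP Y (auxZ SQ α Y) α := by
  have hdisj : ∀ p p' w, w ∈ auxZ SQ α Y p → w ∈ auxZ SQ α Y p' → p = p' := by
    intro p p' w hw hw'
    obtain ⟨A, q, hA, rfl, hwA, -⟩ := hw univ univ_mem
    obtain ⟨B, r, hB, rfl, hwB, hBA⟩ := hw' A (hA.2.1.mem_nhds hwA)
    have h1 := (aux_mem_type (aux_trim hmor hY hA)).1 ⟨w, hwA, hw'⟩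
    have h2 := (aux_mem_type (aux_trim hmor hY hB)).1 ⟨w, hwB, hw⟩
    exact aux_le_antisymm h1 h2
  refine ⟨⟨⟨?_, ?_, ?_⟩, ?_, ?_, ?_⟩, ?_, ?_⟩
  · intro p
    obtain ⟨q, rfl⟩ := hsurj p
    exact (hY.1.1 q).mono (aux_Y_sub hY q)
  · intro p p' hne
    rw [Set.disjoint_left]
    exact fun w hw hw' => hne (hdisj p p' w hw hw')
  · intro p
    ext w
    simp only [mem_inter_iff, mem_iUnion, mem_setOf_eq, exists_prop]
    constructor
    · rintro ⟨hl, p', hw⟩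
      obtain ⟨A, q, hA, rfl, hwA, -⟩ := hw univ univ_mem
      have hT := aux_trim hmor hY hA
      obtain ⟨z, hzA, hz, hzw⟩ := mem_closure_iff.1 hl A hA.2.1 hwA
      refine ⟨α q, ?_, hw⟩
      rcases (aux_mem_type hT).1 ⟨z, hzA, hz⟩ with h | h
      · exact h
      · by_contra hn
        rw [← h] at hn hz
        exact hzw ((hT.2.2.2 hn).unique ⟨hzA, hz⟩ ⟨hwA, hw⟩)
    · rintro ⟨p', hlt, hw⟩
      refine ⟨?_, p', hw⟩
      show w ∈ closure _
      rw [mem_closure_iff]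
      intro U hU hwU
      obtain ⟨A, q, hA, rfl, hwA, hAU⟩ := hw U (hU.mem_nhds hwU)
      obtain ⟨r, hr, rfl⟩ := aux_mor_lift hmor hlt
      obtain ⟨z, hzA, hz⟩ := (aux_mem_type hA).2 (Or.inl hr)
      by_cases hzw : z = w
      · subst hzw
        by_cases hqr : q = r
        · subst hqr
          have hzl : z ∈ limitPts (Y q) ∩ ⋃ q, Y q := by
            rw [hY.1.2.2 q]
            exact mem_biUnion (show q ∈ {x | SQ.lt x q} from hr) hz
          obtain ⟨y, hyA, hy, hyz⟩ := mem_closure_iff.1 hzl.1 A hA.2.1 hzA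
          exact ⟨y, hAU hyA, aux_Y_sub hY q hy, hyz⟩
        · have e := hdisj _ _ z hw (aux_Y_sub hY r hz)
          obtain ⟨y, hyA, hy⟩ := (aux_mem_type hA).2 (Or.inr rfl)
          refine ⟨y, hAU hyA, e ▸ aux_Y_sub hY q hy, ?_⟩
          rintro rfl
          exact Set.disjoint_left.1 (hY.1.2.1 hqr) hy hz
      · exact ⟨z, hAU hzA, aux_Y_sub hY r hz, hzw⟩
  · intro w U hU
    obtain ⟨A, ⟨q, hA⟩, h⟩ := hY.2.1 w U hU
    exact ⟨A, ⟨α q, aux_trim hmor hY hA⟩, h⟩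
  · intro p _ w hw U hU
    obtain ⟨A, hA, hwA, hAU⟩ := hw U hU
    obtain ⟨B, ⟨q, hB⟩, hwB, hBA⟩ := hY.2.1 w A (hA.2.1.mem_nhds hwA)
    obtain ⟨C, hC, hwC, hCB⟩ := hw B (hB.2.1.mem_nhds hwB)
    have hB' := aux_trim hmor hY hB
    exact ⟨B, q, hB, aux_le_antisymm (aux_sub_le hB' hC hCB) (aux_sub_le hA hB' hBA), hwB,
      hBA.trans hAU⟩
  · intro p w hw
    obtain ⟨A, q, hA, rfl, hwA, -⟩ := hw univ univ_mem
    exact ⟨A, aux_trim hmor hY hA, hwA⟩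
  · exact fun q => aux_Y_sub hY q
  · intro p _ A hA
    obtain ⟨w, hwA, hw⟩ := (aux_mem_type hA).2 (Or.inr rfl)
    obtain ⟨B, q, hB, rfl, hwB, hBA⟩ := hw A (hA.2.1.mem_nhds hwA)
    exact ⟨q, ((aux_mem_type hB).2 (Or.inr rfl)).mono (inter_subset_inter_left _ hBA), rfl⟩

theorem aux_Z_sub {SQ : POSystem Q} {SP : POSystem P} {α : Q → P} {Y : Q → Set W}
    {Z : P → Set W} (hZ : IsTrimPartition SP Z) (hR : RegRefines SQ SP Y Z α) (p : P) :
    Z p ⊆ closure (⋃ q ∈ α ⁻¹' {p}, Y q) := by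
  intro w hw
  rw [mem_closure_iff]
  intro U hU hwU
  obtain ⟨A, hA, hwA, hAU⟩ := aux_base hZ hw (hU.mem_nhds hwU)
  obtain ⟨q, ⟨y, hyA, hy⟩, hq⟩ := hR.2 p ⟨A, hA⟩ A hA
  exact ⟨y, hAU hyA, mem_biUnion (show q ∈ α ⁻¹' {p} from hq) hy⟩

end Aux

/-- the regular consolidation `𝒴α` of a bounded trim `(Q, M, g)`-partition
along a surjective morphism `α : Q → P` is a bounded trim `(P, L, f)`-partition, where
`L = {p | α⁻¹(p) ⊆ M}` and `f(p) = Σ_{q ∈ α⁻¹(p)} g(q)` for `p ∈ L_min^d`. -/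
theorem consolidation_bounded_trimPLF {P : Type u} {Q : Type v} {W : Type*}
    [Countable P] [Countable Q]
    [TopologicalSpace W] [SecondCountableTopology W] [LocallyCompactSpace W]
    [T2Space W] [TotallyDisconnectedSpace W]
    (SP : POSystem P) (SQ : POSystem Q) (α : Q → P)
    (hsurj : Function.Surjective α) (hmor : POSystem.IsMorphism SQ SP α)
    (M : Set Q) (g : Q → ℕ) (hext : POSystem.IsExtPO SQ M g)
    (Y : Q → Set W) (hY : IsBoundedTrimPLF SQ M g Y) :
    -- the regular consolidation `𝒴α` exists ...
    (∃ Z : P → Set W, IsTrimPartition SP Z ∧ RegRefines SQ SP Y Z α) ∧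
    -- ... and (being unique) it is a bounded trim `(P, L, f)`-partition
    ∀ Z : P → Set W, IsTrimPartition SP Z → RegRefines SQ SP Y Z α →
      (∀ p : P, IsCompact (closure (Z p)) ↔ α ⁻¹' {p} ⊆ M) ∧
      (∀ p ∈ POSystem.LminD SP {p : P | α ⁻¹' {p} ⊆ M},
        ∃ h : (α ⁻¹' {p}).Finite, Nat.card (Z p) = ∑ q ∈ h.toFinset, g q) ∧
      IsCompact (closure (⋃ p ∈ {p : P | α ⁻¹' {p} ⊆ M}, Z p)) := by
  have hYt : IsTrimPartition SQ Y := hY.1.1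
  refine ⟨⟨_, aux_exists hsurj hmor hYt⟩, ?_⟩
  intro Z hZ hR
  have hK := hY.2
  have hc : ∀ p : P, IsCompact (closure (Z p)) ↔ α ⁻¹' {p} ⊆ M := by
    intro p
    constructor
    · intro h q hq
      have hq' : α q = p := hq
      rw [← hY.1.2.1 q]
      exact h.of_isClosed_subset isClosed_closure (closure_mono (hq' ▸ hR.1 q))
    · intro h
      refine hK.of_isClosed_subset isClosed_closure (closure_minimal ?_ isClosed_closure)
      exact (aux_Z_sub hZ hR p).trans (closure_mono (biUnion_subset_biUnion_left h))
  refine ⟨hc, ?_, ?_⟩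
  · rintro p ⟨⟨hpL, hmin⟩, hpd⟩
    have hpM : α ⁻¹' {p} ⊆ M := hpL
    have hlow : ∀ p', SP.le p' p → p' = p := by
      intro p' h
      refine hmin p' ?_ h
      rintro r hr
      have hr' : α r = p' := hr
      rcases h with h | h
      · rw [← hr'] at h
        obtain ⟨s, hs, hsp⟩ := aux_mor_lift hmor h
        exact hext.1 s (hpM hsp) r (Or.inl hs)
      · exact hpM (hr'.trans h)
    have hcomp : IsCompact (closure (Z p)) := (hc p).2 hpM
    have hfin : (Z p).Finite := by
      have hn : ∀ w ∈ closure (Z p), ∃ A ∈ nhds w, (A ∩ Z p).Finite := by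
        intro w hw
        obtain ⟨A, ⟨p', hA⟩, hwA, -⟩ := hZ.2.1 w univ univ_mem
        have hne := mem_closure_iff.1 hw A hA.2.1 hwA
        obtain rfl := hlow p' ((aux_mem_type hA).1 hne)
        obtain ⟨x, -, hx⟩ := hA.2.2.2 hpd
        exact ⟨A, hA.2.1.mem_nhds hwA, (finite_singleton x).subset fun y hy => hx y hy⟩
      choose! A hA hAf using hn
      obtain ⟨t, ht, hcov⟩ := hcomp.elim_nhds_subcover A hA
      refine (t.finite_toSet.biUnion (t := fun x => A x ∩ Z p) fun x hx => hAf x (ht x hx)).subset ?_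
      intro z hz
      obtain ⟨x, hx, hzx⟩ := mem_iUnion₂.1 (hcov (subset_closure hz))
      exact mem_biUnion hx ⟨hzx, hz⟩
    have hsub : (⋃ q ∈ α ⁻¹' {p}, Y q) ⊆ Z p := by
      refine iUnion₂_subset ?_
      rintro q rfl
      exact hR.1 q
    have heq : Z p = ⋃ q ∈ α ⁻¹' {p}, Y q := by
      refine Subset.antisymm ?_ hsub
      have := aux_Z_sub hZ hR p
      rwa [(hfin.subset hsub).isClosed.closure_eq] at this
    have hYf : ∀ q ∈ α ⁻¹' {p}, Y q ⊆ Z p := by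
      rintro q rfl
      exact hR.1 q
    have hfib : (α ⁻¹' {p}).Finite := by
      choose y hy using hYt.1.1
      refine Set.Finite.of_finite_image (f := y) (hfin.subset ?_) ?_
      · rintro _ ⟨q, hq, rfl⟩
        exact hYf q hq (hy q)
      · intro a _ b _ hab
        by_contra hne
        exact Set.disjoint_left.1 (hYt.1.2.1 hne) (hy a) (hab ▸ hy b)
    refine ⟨hfib, ?_⟩
    have hcard : ∀ q ∈ α ⁻¹' {p}, (Y q).ncard = g q := by
      intro q hq
      have hq' : α q = p := hq
      refine hY.1.2.2 q ⟨⟨hpM hq, ?_⟩, fun h => hpd (hq' ▸ aux_mor_lt hmor h)⟩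
      rintro r hr (h | h)
      · have h1 := aux_mor_lt hmor h
        rw [hq'] at h1
        have h2 := hlow _ (Or.inl h1)
        exact absurd (h2 ▸ h1) hpd
      · exact h
    classical
    have hbi : (Z p) = ↑(hfib.toFinset.biUnion fun q =>
        if h : (Y q).Finite then h.toFinset else ∅) := by
      rw [heq]
      ext w
      simp only [mem_iUnion, Finset.coe_biUnion, Finset.mem_coe, Finite.mem_toFinset, exists_prop]
      refine exists_congr fun q => and_congr_right fun hq => ?_
      rw [dif_pos (hfin.subset (hYf q hq))]
      simp
    change (Z p).ncard = _
    rw [hbi, Set.ncard_coe_finset, Finset.card_biUnion]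
    · refine Finset.sum_congr rfl fun q hq => ?_
      have hq' := hfib.mem_toFinset.1 hq
      rw [dif_pos (hfin.subset (hYf q hq')), ← hcard q hq',
        Set.ncard_eq_toFinset_card _ (hfin.subset (hYf q hq'))]
    · intro a ha b hb hab
      simp only [Function.onFun]
      rw [dif_pos (hfin.subset (hYf a (hfib.mem_toFinset.1 ha))),
        dif_pos (hfin.subset (hYf b (hfib.mem_toFinset.1 hb)))]
      rw [Set.Finite.disjoint_toFinset]
      exact hYt.1.2.1 hab
  · refine hK.of_isClosed_subset isClosed_closure (closure_minimal ?_ isClosed_closure)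
    refine iUnion₂_subset fun p hp => ?_
    exact (aux_Z_sub hZ hR p).trans (closure_mono (biUnion_subset_biUnion_left hp))
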